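/- Let Q be a generalized Nevanlinna function with one negative square and let z₀ ∈ ℂ⁺ be a point at which Q is holomorphic. If Q(z₀) = 0, then Q′(z₀) ≠ 0. -/

import Mathlib

open Complex MeasureTheory Filter Set

noncomputable def negEigCount {n : ℕ} (A : Matrix (Fin n) (Fin n) ℂ) : ℕ :=
  if h : A.IsHermitian then (Finset.univ.filter (fun i => h.eigenvalues i < 0)).card else 0

noncomputable def nevKernel (Q : ℂ → ℂ) {n : ℕ} (z : Fin n → ℂ) :
    Matrix (Fin n) (Fin n) ℂ :=
  Matrix.of fun i j => (Q (z i) - (starRingEnd ℂ) (Q (z j))) / (z i - (starRingEnd ℂ) (z j))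

/-- A generalized Nevanlinna function with one negative square: `Q` is holomorphic on a
domain `D ⊆ ℂ∖ℝ` whose complement in `ℂ∖ℝ` is discrete, is symmetric with respect to
conjugation, and the supremum over finite tuples of points of `D ∩ ℂ⁺` of the number of
negative eigenvalues of the Nevanlinna kernel matrix equals `1`. -/
structure IsGenNevanlinnaOne (Q : ℂ → ℂ) (D : Set ℂ) : Prop where
  subset : D ⊆ {z : ℂ | z.im ≠ 0}
  isOpen : IsOpen D
  discrete_compl : DiscreteTopology ↥({z : ℂ | z.im ≠ 0} \ D)
  holo : DifferentiableOn ℂ Q D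
  conj_mem : ∀ z ∈ D, (starRingEnd ℂ) z ∈ D
  symm : ∀ z ∈ D, Q ((starRingEnd ℂ) z) = (starRingEnd ℂ) (Q z)
  le_one : ∀ (n : ℕ) (z : Fin n → ℂ), (∀ i, z i ∈ D ∧ 0 < (z i).im) →
    negEigCount (nevKernel Q z) ≤ 1
  exists_one : ∃ (n : ℕ) (z : Fin n → ℂ), (∀ i, z i ∈ D ∧ 0 < (z i).im) ∧
    negEigCount (nevKernel Q z) = 1

/-- A Nevanlinna function. -/
structure IsNevanlinna (M : ℂ → ℂ) : Prop where
  holo : DifferentiableOn ℂ M {z : ℂ | z.im ≠ 0}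
  symm : ∀ z : ℂ, z.im ≠ 0 → M ((starRingEnd ℂ) z) = (starRingEnd ℂ) (M z)
  im_nonneg : ∀ z : ℂ, 0 < z.im → 0 ≤ (M z).im

open scoped ComplexConjugate ComplexOrder Topology

theorem nevKernel_isHermitian (Q : ℂ → ℂ) {n : ℕ} (z : Fin n → ℂ) :
    (nevKernel Q z).IsHermitian := by
  ext i j
  simp only [nevKernel, Matrix.conjTranspose_apply, Matrix.of_apply, RCLike.star_def, map_div₀,
    map_sub, Complex.conj_conj]
  rw [← neg_div_neg_eq, neg_sub, neg_sub]

theorem negEigCount_zero (n : ℕ) : negEigCount (0 : Matrix (Fin n) (Fin n) ℂ) = 0 := by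
  have h : (0 : Matrix (Fin n) (Fin n) ℂ).IsHermitian := Matrix.isHermitian_zero
  have h0 : h.eigenvalues = 0 := h.eigenvalues_eq_zero_iff.mpr rfl
  simp [negEigCount, h0]

/-- A Hermitian matrix with positive determinant has an even number of negative eigenvalues; if
it has at most one, it is positive definite. -/
theorem posDef_of_negEigCount_le_one {n : ℕ} {A : Matrix (Fin n) (Fin n) ℂ}
    (hA : A.IsHermitian) (hneg : negEigCount A ≤ 1) (hdet : 0 < A.det.re) : A.PosDef := by
  rw [hA.posDef_iff_eigenvalues_pos]
  have hprod : A.det.re = ∏ i, hA.eigenvalues i := by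
    rw [hA.det_eq_prod_eigenvalues]
    have : ∏ i, ((hA.eigenvalues i : ℝ) : ℂ) = ((∏ i, hA.eigenvalues i : ℝ) : ℂ) := by
      push_cast; rfl
    exact (congrArg Complex.re this).trans (Complex.ofReal_re _)
  rw [hprod] at hdet
  rw [negEigCount, dif_pos hA, Finset.card_le_one] at hneg
  have hne : ∀ i, hA.eigenvalues i ≠ 0 := fun i =>
    Finset.prod_ne_zero_iff.mp hdet.ne' i (Finset.mem_univ i)
  intro i
  by_contra hi
  have hi' : hA.eigenvalues i < 0 := lt_of_le_of_ne (not_lt.mp hi) (hne i)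
  have hrest : 0 < ∏ j ∈ Finset.univ.erase i, hA.eigenvalues j := by
    refine Finset.prod_pos fun j hj => ?_
    by_contra hj'
    have hj'' : hA.eigenvalues j < 0 := lt_of_le_of_ne (not_lt.mp hj') (hne j)
    exact Finset.ne_of_mem_erase hj (hneg j (by simpa using hj'') i (by simpa using hi'))
  rw [← Finset.mul_prod_erase _ _ (Finset.mem_univ i)] at hdet
  exact absurd hdet (not_lt.mpr (mul_nonpos_of_nonpos_of_nonneg hi'.le hrest.le))

/-- The Nevanlinna kernel matrix at `a, a + h, u, v`, with the second row and column replaced by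
difference quotients of step `h`, where `Q a = 0`, `Q (a + h) = h * q`, `Q u = s`, `Q v = t`. -/
noncomputable def nevDiffKernel (a u v s t : ℂ) (h : ℝ) (q : ℂ) : Matrix (Fin 4) (Fin 4) ℂ :=
  !![0, -conj q / (a - conj a - h), -conj s / (a - conj u), -conj t / (a - conj v);
    q / (a - conj a + h),
      q / ((a - conj a) * (a - conj a + h)) + conj q / ((a - conj a) * (a - conj a - h)),
      q / (a - conj u + h) + conj s / ((a - conj u + h) * (a - conj u)),
      q / (a - conj v + h) + conj t / ((a - conj v + h) * (a - conj v));
    s / (u - conj a), -conj q / (u - conj a - h) + s / ((u - conj a - h) * (u - conj a)),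
      (s - conj s) / (u - conj u), (s - conj t) / (u - conj v);
    t / (v - conj a), -conj q / (v - conj a - h) + t / ((v - conj a - h) * (v - conj a)),
      (t - conj s) / (v - conj u), (t - conj t) / (v - conj v)]

theorem sub_conj_add_ofReal_ne_zero {z w : ℂ} (hz : 0 < z.im) (hw : 0 < w.im) (h : ℝ) :
    z - conj w + h ≠ 0 := by
  intro h0
  have := congrArg Complex.im h0
  simp at this
  linarith

theorem sub_conj_sub_ofReal_ne_zero {z w : ℂ} (hz : 0 < z.im) (hw : 0 < w.im) (h : ℝ) :
    z - conj w - h ≠ 0 := by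
  simpa [sub_eq_add_neg] using sub_conj_add_ofReal_ne_zero hz hw (-h)

theorem sub_conj_ne_zero {z w : ℂ} (hz : 0 < z.im) (hw : 0 < w.im) : z - conj w ≠ 0 := by
  simpa using sub_conj_add_ofReal_ne_zero hz hw 0

theorem det_nevKernel_eq (Q : ℂ → ℂ) {a u v q : ℂ} {h : ℝ} (ha : 0 < a.im) (hu : 0 < u.im)
    (hv : 0 < v.im) (h0 : Q a = 0) (hq : Q (a + h) = h * q) :
    (nevKernel Q ![a, a + h, u, v]).det =
      (h : ℂ) ^ 2 * (nevDiffKernel a u v (Q u) (Q v) h q).det := by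
  let S : Matrix (Fin 4) (Fin 4) ℂ := !![1, 0, 0, 0; 1, h, 0, 0; 0, 0, 1, 0; 0, 0, 0, 1]
  have hS : S.det = h := by
    simp [S, Matrix.det_succ_row_zero, Fin.sum_univ_succ]
  have key : nevKernel Q ![a, a + h, u, v] =
      S * nevDiffKernel a u v (Q u) (Q v) h q * S.transpose := by
    have e1 := sub_conj_ne_zero ha ha
    have e2 := sub_conj_ne_zero ha hu
    have e3 := sub_conj_ne_zero ha hv
    have e4 := sub_conj_ne_zero hu ha
    have e5 := sub_conj_ne_zero hv ha
    have f1 := sub_conj_add_ofReal_ne_zero ha ha h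
    have f2 := sub_conj_add_ofReal_ne_zero ha hu h
    have f3 := sub_conj_add_ofReal_ne_zero ha hv h
    have g1 := sub_conj_sub_ofReal_ne_zero ha ha h
    have g2 := sub_conj_sub_ofReal_ne_zero hu ha h
    have g3 := sub_conj_sub_ofReal_ne_zero hv ha h
    have r1 : ∀ w : ℂ, a + h - w = a - w + h := fun w => by ring
    have r2 : ∀ w : ℂ, w - (conj a + h) = w - conj a - h := fun w => by ring
    ext i j
    fin_cases i <;> fin_cases j <;>
      simp [nevKernel, nevDiffKernel, S, Matrix.mul_apply, Fin.sum_univ_succ, h0, hq, r1, r2] <;>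
      field_simp <;> ring
  rw [key, Matrix.det_mul, Matrix.det_mul, Matrix.det_transpose, hS]
  ring

theorem continuousAt_det_nevDiffKernel {a u v : ℂ} (s t : ℂ) (ha : 0 < a.im) (hu : 0 < u.im)
    (hv : 0 < v.im) :
    ContinuousAt (fun p : ℝ × ℂ => (nevDiffKernel a u v s t p.1 p.2).det) (0, 0) := by
  have e1 := sub_conj_ne_zero ha ha
  have e2 := sub_conj_ne_zero ha hu
  have e3 := sub_conj_ne_zero ha hv
  have e4 := sub_conj_ne_zero hu ha
  have e5 := sub_conj_ne_zero hv ha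
  have hF : ContinuousAt (fun p : ℝ × ℂ => nevDiffKernel a u v s t p.1 p.2) (0, 0) := by
    refine continuousAt_pi.mpr fun i => continuousAt_pi.mpr fun j => ?_
    fin_cases i <;> fin_cases j <;> simp [nevDiffKernel] <;>
      fun_prop (disch := simp [e1, e2, e3, e4, e5])
  exact (Continuous.matrix_det continuous_id).continuousAt.comp hF

theorem det_nevDiffKernel_zero_re_pos {a u v s t : ℂ} (ha : 0 < a.im) (hu : 0 < u.im)
    (hv : 0 < v.im) (huv : u ≠ v) (hs : s ≠ 0) (ht : t ≠ 0) :
    0 < (nevDiffKernel a u v s t 0 0).det.re := by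
  have e4 := sub_conj_ne_zero hu ha
  have e5 := sub_conj_ne_zero hv ha
  have e2 := sub_conj_ne_zero ha hu
  have e3 := sub_conj_ne_zero ha hv
  set b := s * t * (u - v) / ((u - conj a) ^ 2 * (v - conj a) ^ 2) with hb
  have hb0 : b ≠ 0 := by
    have := sub_ne_zero.mpr huv
    positivity
  have hdet : (nevDiffKernel a u v s t 0 0).det = b * conj b := by
    have hcb : conj b = conj s * conj t * (conj u - conj v) /
        ((a - conj u) ^ 2 * (a - conj v) ^ 2) := by
      simp only [hb, map_div₀, map_mul, map_sub, map_pow, Complex.conj_conj]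
      congr 1
      ring
    rw [hcb, hb]
    generalize hc1 : (s - conj s) / (u - conj u) = c1
    generalize hc2 : (s - conj t) / (u - conj v) = c2
    generalize hc3 : (t - conj s) / (v - conj u) = c3
    generalize hc4 : (t - conj t) / (v - conj v) = c4
    simp [nevDiffKernel, hc1, hc2, hc3, hc4, Matrix.det_succ_row_zero, Fin.sum_univ_succ,
      Fin.succAbove]
    field_simp
    ring
  rw [hdet, Complex.mul_conj, Complex.ofReal_re]
  exact Complex.normSq_pos.mpr hb0

namespace IsGenNevanlinnaOne

variable {Q : ℂ → ℂ} {D : Set ℂ}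

theorem exists_ne_zero (hQ : IsGenNevanlinnaOne Q D) : ∃ u ∈ D, 0 < u.im ∧ Q u ≠ 0 := by
  by_contra! hzero
  obtain ⟨n, z, hz, h1⟩ := hQ.exists_one
  have hK : nevKernel Q z = 0 := by
    ext i j
    simp [nevKernel, hzero _ (hz i).1 (hz i).2, hzero _ (hz j).1 (hz j).2]
  rw [hK, negEigCount_zero] at h1
  exact zero_ne_one h1

theorem exists_ne_zero_pair (hQ : IsGenNevanlinnaOne Q D) :
    ∃ u ∈ D, ∃ v ∈ D, 0 < u.im ∧ 0 < v.im ∧ u ≠ v ∧ Q u ≠ 0 ∧ Q v ≠ 0 := by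
  obtain ⟨u, huD, hu, hQu⟩ := hQ.exists_ne_zero
  have hD : D ∈ 𝓝 u := hQ.isOpen.mem_nhds huD
  have hev : ∀ᶠ v in 𝓝[≠] u, v ∈ D ∧ 0 < v.im ∧ Q v ≠ 0 := by
    refine Filter.Eventually.filter_mono nhdsWithin_le_nhds ?_
    have hc := (hQ.holo.differentiableAt hD).continuousAt
    filter_upwards [hD, continuous_im.continuousAt.eventually (lt_mem_nhds hu),
      hc.eventually_ne hQu] with v h1 h2 h3 using ⟨h1, h2, h3⟩
  obtain ⟨v, ⟨hvD, hv, hQv⟩, hvu⟩ := (hev.and self_mem_nhdsWithin).exists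
  exact ⟨u, huD, v, hvD, hu, hv, Ne.symm hvu, hQu, hQv⟩

end IsGenNevanlinnaOne

/-- If a generalized Nevanlinna function with one negative square is
holomorphic at `z₀ ∈ ℂ⁺` and `Q(z₀) = 0`, then `Q′(z₀) ≠ 0`. -/
theorem statement2 (Q : ℂ → ℂ) (D : Set ℂ) (hQ : IsGenNevanlinnaOne Q D)
    (z₀ : ℂ) (hz₀ : z₀ ∈ D) (him : 0 < z₀.im) (h0 : Q z₀ = 0) :
    deriv Q z₀ ≠ 0 := by
  intro hd
  obtain ⟨u, huD, v, hvD, hu, hv, huv, hQu, hQv⟩ := hQ.exists_ne_zero_pair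
  have hD : D ∈ 𝓝 z₀ := hQ.isOpen.mem_nhds hz₀
  have hderiv : HasDerivAt Q 0 z₀ := hd ▸ (hQ.holo.differentiableAt hD).hasDerivAt
  have hcast : Tendsto (fun h : ℝ => (h : ℂ)) (𝓝[≠] 0) (𝓝[≠] 0) := by
    refine tendsto_nhdsWithin_iff.mpr ⟨?_, ?_⟩
    · exact (Complex.continuous_ofReal.tendsto' 0 0 (by simp)).mono_left nhdsWithin_le_nhds
    · filter_upwards [self_mem_nhdsWithin] with h hh
      simpa using hh
  have hslope : Tendsto (fun h : ℝ => (h : ℂ)⁻¹ * Q (z₀ + h)) (𝓝[≠] 0) (𝓝 0) := by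
    simpa [h0, Function.comp_def] using
      (hasDerivAt_iff_tendsto_slope_zero.mp hderiv).comp hcast
  have hdet : Tendsto (fun h : ℝ =>
      (nevDiffKernel z₀ u v (Q u) (Q v) h ((h : ℂ)⁻¹ * Q (z₀ + h))).det.re) (𝓝[≠] 0)
      (𝓝 (nevDiffKernel z₀ u v (Q u) (Q v) 0 0).det.re) := by
    have hpair : Tendsto (fun h : ℝ => (h, (h : ℂ)⁻¹ * Q (z₀ + h))) (𝓝[≠] 0) (𝓝 (0, 0)) :=
      (tendsto_id.mono_left nhdsWithin_le_nhds).prodMk_nhds hslope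
    have hcont := (continuousAt_det_nevDiffKernel (Q u) (Q v) him hu hv).tendsto.comp hpair
    have hre := (continuous_re.tendsto _).comp hcont
    simpa only [Function.comp_def] using hre
  have hmem : ∀ᶠ h : ℝ in 𝓝[≠] 0, z₀ + h ∈ D := by
    have hadd : Tendsto (fun h : ℝ => z₀ + h) (𝓝 0) (𝓝 z₀) :=
      Continuous.tendsto' (by fun_prop) _ _ (by simp)
    exact (hadd.mono_left nhdsWithin_le_nhds).eventually hD
  obtain ⟨h, ⟨hpos, hhD⟩, hne⟩ := ((hdet.eventually (lt_mem_nhds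
    (det_nevDiffKernel_zero_re_pos him hu hv huv hQu hQv))).and hmem |>.and
    self_mem_nhdsWithin).exists
  have hne' : h ≠ 0 := hne
  have hpts : ∀ i, ![z₀, z₀ + h, u, v] i ∈ D ∧ 0 < (![z₀, z₀ + h, u, v] i).im := by
    intro i
    fin_cases i <;> simp [*]
  have hdetpos : 0 < (nevKernel Q ![z₀, z₀ + h, u, v]).det.re := by
    have hq : Q (z₀ + h) = h * ((h : ℂ)⁻¹ * Q (z₀ + h)) := by
      rw [mul_inv_cancel_left₀ (by exact_mod_cast hne')]
    rw [det_nevKernel_eq Q him hu hv h0 hq, ← Complex.ofReal_pow, Complex.re_ofReal_mul]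
    positivity
  have hPD := posDef_of_negEigCount_le_one (nevKernel_isHermitian Q _) (hQ.le_one 4 _ hpts) hdetpos
  have hdiag := hPD.diag_pos (i := 0)
  simp [nevKernel, h0] at hdiag
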